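/- For every integer q ≥ 3, every r ∈ ℕ with r ≤ q − 2, every s ∈ ℕ and every collection Y_s ∈ 𝕐_s, there exist a function f ∈ Δ^(q)(Y_s) ∩ W^r and a constant C > 0 (depending only on q and Y_s) such that E_n^(q)(f, Y_s) ≥ C for all n ∈ ℕ. -/

import Mathlib

noncomputable section

/-- A collection `Y_s ∈ 𝕐_s`: points `y 1 > y 2 > ⋯ > y (2s)` (decreasing in the index),
with the convention `y 0 = y (2s) + 2π`. -/
structure PtsColl (s : ℕ) where
  y : ℕ → ℝ
  lt : ∀ i : ℕ, 1 ≤ i → i ≤ 2 * s → y i < y (i - 1)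
  per : y 0 = y (2 * s) + 2 * Real.pi

/-- `f` is `q`-monotone (for `q ≥ 3`) on `[a,b]`: `f` is continuous on `[a,b]`,
`(q-2)`-times continuously differentiable on `(a,b)`, and `f^{(q-2)}` is convex on `(a,b)`. -/
def QMonotoneOn (q : ℕ) (f : ℝ → ℝ) (a b : ℝ) : Prop :=
  ContinuousOn f (Set.Icc a b) ∧
  ContDiffOn ℝ (q - 2 : ℕ) f (Set.Ioo a b) ∧
  ConvexOn ℝ (Set.Ioo a b) (iteratedDerivWithin (q - 2) f (Set.Ioo a b))

/-- `f ∈ Δ^(q)(Y_s)`: `f` is continuous, `2π`-periodic, and `(-1)^(i-1) f` is `q`-monotone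
on `[y i, y (i-1)]` for each `i = 1, …, 2s`. -/
def DeltaQ (q s : ℕ) (Y : PtsColl s) (f : ℝ → ℝ) : Prop :=
  Continuous f ∧ (∀ x : ℝ, f (x + 2 * Real.pi) = f x) ∧
  ∀ i : ℕ, 1 ≤ i → i ≤ 2 * s →
    QMonotoneOn q (fun x => (-1 : ℝ) ^ (i - 1) * f x) (Y.y i) (Y.y (i - 1))

/-- `T ∈ 𝒯_n`: a real trigonometric polynomial of degree at most `n`. -/
def IsTrigPoly (n : ℕ) (T : ℝ → ℝ) : Prop :=
  ∃ a b : ℕ → ℝ, ∀ t : ℝ,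
    T t = a 0 + ∑ k ∈ Finset.Icc 1 n, (a k * Real.cos (k * t) + b k * Real.sin (k * t))

/-- `f ∈ W^r`: `f` is `2π`-periodic, of class `C^{r-1}`, `f^{(r-1)}` is absolutely continuous
(being the integral of a locally integrable function `g = f^{(r)}`), and `esssup |f^{(r)}| ≤ 2`. -/
def SobolevW (r : ℕ) (f : ℝ → ℝ) : Prop :=
  (∀ x : ℝ, f (x + 2 * Real.pi) = f x) ∧
  ContDiff ℝ (r - 1 : ℕ) f ∧
  ∃ g : ℝ → ℝ,
    (∀ a b : ℝ, IntervalIntegrable g MeasureTheory.volume a b) ∧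
    (∀ᵐ x ∂MeasureTheory.volume, |g x| ≤ 2) ∧
    ∀ x : ℝ, iteratedDeriv (r - 1) f x =
      iteratedDeriv (r - 1) f 0 + ∫ t in (0 : ℝ)..x, g t

/-- `E_n^(q)(f, Y_s)`: the error of the best co-`q`-monotone approximation of `f`
by trigonometric polynomials of degree at most `n` belonging to `Δ^(q)(Y_s)`. -/
def ErrCoQ (q n s : ℕ) (Y : PtsColl s) (f : ℝ → ℝ) : ℝ :=
  sInf ((fun T => ⨆ x : ℝ, |f x - T x|) '' {T : ℝ → ℝ | IsTrigPoly n T ∧ DeltaQ q s Y T})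

open Real Set MeasureTheory

section DerivativeTowers

variable {H : ℕ → ℝ → ℝ}

lemma iteratedDeriv_tower (h : ∀ i x, HasDerivAt (H (i + 1)) (H i x) x) (j : ℕ) :
    iteratedDeriv j (H j) = H 0 := by
  induction j with
  | zero => simp
  | succ j ih =>
    rw [iteratedDeriv_succ', ← ih]
    congr 1
    exact funext fun x => (h j x).deriv

lemma contDiff_tower (h : ∀ i x, HasDerivAt (H (i + 1)) (H i x) x) (h0 : Continuous (H 0))
    (j : ℕ) : ContDiff ℝ j (H j) := by
  induction j with
  | zero => exact contDiff_zero.2 h0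
  | succ j ih =>
    push_cast
    refine contDiff_succ_iff_deriv.2 ⟨fun x => (h j x).differentiableAt, by simp, ?_⟩
    rwa [show deriv (H (j + 1)) = H j from funext fun x => (h j x).deriv]

end DerivativeTowers

section PeriodicIntegration

lemma periodic_iteratedDeriv {f : ℝ → ℝ} {c : ℝ} (hf : Function.Periodic f c) (n : ℕ) :
    Function.Periodic (iteratedDeriv n f) c := by
  intro x
  have h := congrFun (iteratedDeriv_comp_add_const n f c) x
  rw [← h]
  congr 1
  exact funext hf

lemma hasDerivAt_iteratedDeriv {f : ℝ → ℝ} (hf : ContDiff ℝ ⊤ f) (n : ℕ) (x : ℝ) :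
    HasDerivAt (iteratedDeriv n f) (iteratedDeriv (n + 1) f x) x := by
  rw [iteratedDeriv_succ]
  exact ((hf.differentiable_iteratedDeriv n (by exact_mod_cast WithTop.coe_lt_top _)) x).hasDerivAt

lemma continuous_iteratedDeriv_top {f : ℝ → ℝ} (hf : ContDiff ℝ ⊤ f) (n : ℕ) :
    Continuous (iteratedDeriv n f) := hf.continuous_iteratedDeriv n (by simp)

lemma integral_mul_iteratedDeriv_of_periodic {f g : ℝ → ℝ} {a c : ℝ} (hf : ContDiff ℝ ⊤ f)
    (hg : ContDiff ℝ ⊤ g) (pf : Function.Periodic f c) (pg : Function.Periodic g c) (n m : ℕ) :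
    ∫ x in a..a + c, iteratedDeriv m f x * iteratedDeriv n g x =
      (-1) ^ n * ∫ x in a..a + c, iteratedDeriv (m + n) f x * g x := by
  induction n generalizing m with
  | zero => simp
  | succ n ih =>
    rw [intervalIntegral.integral_mul_deriv_eq_deriv_mul
      (u' := iteratedDeriv (m + 1) f) (v := iteratedDeriv n g)
      (fun x _ => hasDerivAt_iteratedDeriv hf m x)
      (fun x _ => hasDerivAt_iteratedDeriv hg n x)
      ((continuous_iteratedDeriv_top hf _).intervalIntegrable _ _)
      ((continuous_iteratedDeriv_top hg _).intervalIntegrable _ _), ih,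
      periodic_iteratedDeriv pf, periodic_iteratedDeriv pg,
      show m + 1 + n = m + (n + 1) by ring]
    ring

end PeriodicIntegration

section Bernoulli

/-- The Bernoulli polynomial of degree `k` rescaled to `[0, 2π]`, normalised so that each one is
an antiderivative of the previous one. -/
def scaledBernoulli (k : ℕ) (u : ℝ) : ℝ :=
  (2 * π) ^ k / k.factorial * bernoulliFun k (u / (2 * π))

/-- The `2π`-periodic function that agrees with `scaledBernoulli k (x - a)` on `[a, a + 2π)`. -/
def periodicBernoulli (a : ℝ) (k : ℕ) (x : ℝ) : ℝ :=
  (2 * π) ^ k / k.factorial * bernoulliFun k (Int.fract ((x - a) / (2 * π)))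

lemma hasDerivAt_scaledBernoulli (k : ℕ) (u : ℝ) :
    HasDerivAt (scaledBernoulli (k + 1)) (scaledBernoulli k u) u := by
  have h := ((hasDerivAt_bernoulliFun (k + 1) (u / (2 * π))).comp u
    ((hasDerivAt_id u).div_const (2 * π))).const_mul ((2 * π) ^ (k + 1) / (k + 1).factorial)
  refine h.congr_deriv ?_
  have hπ := pi_ne_zero
  have hk : ((k.factorial : ℕ) : ℝ) ≠ 0 := by positivity
  simp only [scaledBernoulli, Nat.factorial_succ, Nat.add_sub_cancel]
  push_cast
  field_simp
  ring

lemma contDiff_scaledBernoulli (k : ℕ) : ContDiff ℝ ⊤ (scaledBernoulli k) :=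
  contDiff_const.mul ((contDiff_bernoulliFun k).comp (contDiff_id.div_const _))

lemma scaledBernoulli_one (u : ℝ) : scaledBernoulli 1 u = u - π := by
  have hπ := pi_ne_zero
  simp only [scaledBernoulli, bernoulliFun_one, pow_one, Nat.factorial_one, Nat.cast_one]
  field_simp

lemma scaledBernoulli_two_pi {k : ℕ} (hk : k ≠ 1) :
    scaledBernoulli k (2 * π) = scaledBernoulli k 0 := by
  simp [scaledBernoulli, bernoulliFun_endpoints_eq_of_ne_one hk]

lemma periodicBernoulli_periodic (a : ℝ) (k : ℕ) :
    Function.Periodic (periodicBernoulli a k) (2 * π) := by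
  intro x
  have hπ : 2 * π ≠ 0 := by positivity
  have : (x + 2 * π - a) / (2 * π) = (x - a) / (2 * π) + 1 := by field_simp; ring
  rw [periodicBernoulli, this, Int.fract_add_one]
  rfl

lemma continuous_periodicBernoulli (a : ℝ) {k : ℕ} (hk : k ≠ 1) :
    Continuous (periodicBernoulli a k) := by
  have h : Continuous (bernoulliFun k ∘ Int.fract) :=
    ContinuousOn.comp_fract'' (continuous_bernoulliFun k).continuousOn
      (bernoulliFun_endpoints_eq_of_ne_one hk).symm
  exact continuous_const.mul (h.comp (by fun_prop : Continuous fun x : ℝ => (x - a) / (2 * π)))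

lemma measurable_periodicBernoulli (a : ℝ) (k : ℕ) : Measurable (periodicBernoulli a k) := by
  have h := (continuous_bernoulliFun k).measurable
  exact measurable_const.mul (h.comp (measurable_fract.comp
    (by fun_prop : Measurable fun x : ℝ => (x - a) / (2 * π))))

lemma exists_bound_periodicBernoulli (a : ℝ) (k : ℕ) :
    ∃ B, ∀ x, |periodicBernoulli a k x| ≤ B := by
  obtain ⟨B, hB⟩ := isCompact_Icc.exists_bound_of_continuousOn (s := Icc (0 : ℝ) 1)
    (continuous_const.mul (continuous_bernoulliFun k) :
      Continuous fun t => (2 * π) ^ k / k.factorial * bernoulliFun k t).continuousOn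
  exact ⟨B, fun x => hB _ ⟨Int.fract_nonneg _, (Int.fract_lt_one _).le⟩⟩

lemma periodicBernoulli_eqOn (a : ℝ) (k : ℕ) (n : ℤ) :
    EqOn (periodicBernoulli a k) (fun x => scaledBernoulli k (x - (a + 2 * π * n)))
      (Ioo (a + 2 * π * n) (a + 2 * π * n + 2 * π)) := by
  intro x ⟨h1, h2⟩
  have hπ : 0 < 2 * π := by positivity
  have hf : Int.fract ((x - a) / (2 * π)) = (x - (a + 2 * π * n)) / (2 * π) := by
    rw [Int.fract_eq_iff]
    refine ⟨div_nonneg (by linarith) hπ.le, (div_lt_one hπ).2 (by linarith), n, ?_⟩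
    field_simp
    ring
  simp only [periodicBernoulli, scaledBernoulli, hf]

lemma hasDerivAt_periodicBernoulli_off (a : ℝ) (k : ℕ) {x : ℝ}
    (hx : x ∉ range fun n : ℤ => a + 2 * π * n) :
    HasDerivAt (periodicBernoulli a (k + 1)) (periodicBernoulli a k x) x := by
  have hπ : 0 < 2 * π := by positivity
  set n := ⌊(x - a) / (2 * π)⌋
  have h1 : (n : ℝ) ≤ (x - a) / (2 * π) := Int.floor_le _
  have h2 : (x - a) / (2 * π) < n + 1 := Int.lt_floor_add_one _
  rw [le_div_iff₀ hπ] at h1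
  rw [div_lt_iff₀ hπ] at h2
  have hne : a + 2 * π * n ≠ x := fun h => hx ⟨n, h⟩
  have hmem : x ∈ Ioo (a + 2 * π * n) (a + 2 * π * n + 2 * π) :=
    ⟨lt_of_le_of_ne (by linarith) hne, by linarith⟩
  have h := (hasDerivAt_scaledBernoulli k (x - (a + 2 * π * n))).comp_sub_const x (a + 2 * π * n)
  rw [periodicBernoulli_eqOn a k n hmem]
  exact h.congr_of_eventuallyEq
    ((periodicBernoulli_eqOn a (k + 1) n).eventuallyEq_of_mem (isOpen_Ioo.mem_nhds hmem))

lemma intervalIntegrable_periodicBernoulli (a : ℝ) (k : ℕ) (b c : ℝ) :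
    IntervalIntegrable (periodicBernoulli a k) volume b c := by
  obtain ⟨B, hB⟩ := exists_bound_periodicBernoulli a k
  exact (intervalIntegrable_const (c := B)).mono_fun'
    (measurable_periodicBernoulli a k).aestronglyMeasurable (Filter.Eventually.of_forall hB)

lemma integral_periodicBernoulli (a : ℝ) {k : ℕ} (hk : 1 ≤ k) (b c : ℝ) :
    ∫ t in b..c, periodicBernoulli a k t =
      periodicBernoulli a (k + 1) c - periodicBernoulli a (k + 1) b :=
  integral_eq_of_hasDerivAt_off_countable _ _ (countable_range fun n : ℤ => a + 2 * π * n)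
    (continuous_periodicBernoulli a (by omega)).continuousOn
    (fun _ hx => hasDerivAt_periodicBernoulli_off a k hx.2)
    (intervalIntegrable_periodicBernoulli a k b c)

lemma hasDerivAt_periodicBernoulli (a : ℝ) {k : ℕ} (hk : 2 ≤ k) (x : ℝ) :
    HasDerivAt (periodicBernoulli a (k + 1)) (periodicBernoulli a k x) x := by
  have hc := continuous_periodicBernoulli a (k := k) (by omega)
  have h := (intervalIntegral.integral_hasDerivAt_right
    (intervalIntegrable_periodicBernoulli a k 0 x)
    hc.stronglyMeasurable.stronglyMeasurableAtFilter hc.continuousAt).add_const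
    (periodicBernoulli a (k + 1) 0)
  refine h.congr_of_eventuallyEq (Filter.Eventually.of_forall fun y => ?_)
  simp [integral_periodicBernoulli a (by omega : 1 ≤ k)]

lemma integral_scaledBernoulli_mul_iteratedDeriv {g : ℝ → ℝ} (hg : ContDiff ℝ ⊤ g)
    (pg : Function.Periodic g (2 * π)) (a : ℝ) (k : ℕ) :
    ∫ x in a..a + 2 * π, scaledBernoulli (k + 1) (x - a) * iteratedDeriv (k + 2) g x =
      (-1) ^ k * (2 * π * deriv g a) := by
  have parts : ∀ k : ℕ,
      ∫ x in a..a + 2 * π, scaledBernoulli (k + 1) (x - a) * iteratedDeriv (k + 2) g x =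
      (scaledBernoulli (k + 1) (2 * π) - scaledBernoulli (k + 1) 0) * iteratedDeriv (k + 1) g a -
        ∫ x in a..a + 2 * π, scaledBernoulli k (x - a) * iteratedDeriv (k + 1) g x := by
    intro k
    have hc : Continuous fun x => scaledBernoulli k (x - a) :=
      (contDiff_scaledBernoulli k).continuous.comp (continuous_sub_right a)
    rw [intervalIntegral.integral_mul_deriv_eq_deriv_mul
      (u' := fun x => scaledBernoulli k (x - a)) (v := iteratedDeriv (k + 1) g)
      (fun x _ => (hasDerivAt_scaledBernoulli k (x - a)).comp_sub_const x a)
      (fun x _ => hasDerivAt_iteratedDeriv hg (k + 1) x)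
      (hc.intervalIntegrable _ _)
      ((continuous_iteratedDeriv_top hg _).intervalIntegrable _ _),
      periodic_iteratedDeriv pg]
    simp only [add_sub_cancel_left, sub_self]
    ring
  induction k with
  | zero =>
    have h0 : ∀ u, scaledBernoulli 0 u = 1 := by simp [scaledBernoulli]
    rw [parts]
    simp only [zero_add, scaledBernoulli_one, h0, one_mul]
    rw [intervalIntegral.integral_eq_sub_of_hasDerivAt
      (fun x _ => hasDerivAt_iteratedDeriv hg 0 x)
      ((continuous_iteratedDeriv_top hg _).intervalIntegrable _ _),
      periodic_iteratedDeriv pg, iteratedDeriv_one]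
    ring
  | succ k ih =>
    rw [parts, scaledBernoulli_two_pi (by omega), ih]
    ring

lemma integral_periodicBernoulli_mul_iteratedDeriv {g : ℝ → ℝ} (hg : ContDiff ℝ ⊤ g)
    (pg : Function.Periodic g (2 * π)) (a : ℝ) (k : ℕ) :
    ∫ x in a..a + 2 * π, periodicBernoulli a (k + 1) x * iteratedDeriv (k + 2) g x =
      (-1) ^ k * (2 * π * deriv g a) := by
  rw [← integral_scaledBernoulli_mul_iteratedDeriv hg pg]
  refine intervalIntegral.integral_congr_Ioo_of_le (by linarith [pi_pos]) fun x hx => ?_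
  have := periodicBernoulli_eqOn a (k + 1) 0 (x := x) (by simpa using hx)
  simp [this]

end Bernoulli

section SignFunction

variable {s : ℕ} (Y : PtsColl s)

lemma PtsColl.y_lt_y {i j : ℕ} (hij : i < j) (hj : j ≤ 2 * s) : Y.y j < Y.y i := by
  induction j, hij using Nat.le_induction with
  | base => exact Y.lt (i + 1) (by omega) hj
  | succ k hk ih => exact (Y.lt (k + 1) (by omega) hj).trans (ih (by omega))

lemma PtsColl.y_le_y {i j : ℕ} (hij : i ≤ j) (hj : j ≤ 2 * s) : Y.y j ≤ Y.y i := by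
  rcases hij.eq_or_lt with rfl | h
  · rfl
  · exact (Y.y_lt_y h hj).le

/-- A smooth `2π`-periodic function with the sign pattern prescribed by `Y`. -/
def PtsColl.signFun (x : ℝ) : ℝ := ∏ j ∈ Finset.Icc 1 (2 * s), sin ((x - Y.y j) / 2)

lemma PtsColl.contDiff_signFun : ContDiff ℝ ⊤ Y.signFun := by
  unfold PtsColl.signFun
  exact contDiff_prod fun j _ => contDiff_sin.comp ((contDiff_id.sub contDiff_const).div_const _)

lemma PtsColl.signFun_periodic : Function.Periodic Y.signFun (2 * π) := by
  intro x
  have h : ∀ j, sin ((x + 2 * π - Y.y j) / 2) = -1 * sin ((x - Y.y j) / 2) := by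
    intro j
    rw [show (x + 2 * π - Y.y j) / 2 = (x - Y.y j) / 2 + π by ring, sin_add_pi]
    ring
  simp only [PtsColl.signFun, h, Finset.prod_mul_distrib]
  simp

lemma PtsColl.signFun_nonneg {i : ℕ} (hi : 1 ≤ i) (his : i ≤ 2 * s) {x : ℝ}
    (hx : x ∈ Icc (Y.y i) (Y.y (i - 1))) : 0 ≤ (-1) ^ (i - 1) * Y.signFun x := by
  have hper := Y.per
  have hneg : (-1 : ℝ) ^ (i - 1) = ∏ j ∈ Finset.Ico 1 i, (-1 : ℝ) := by simp
  rw [PtsColl.signFun, ← Finset.Ico_add_one_right_eq_Icc,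
    ← Finset.prod_Ico_consecutive _ hi (by omega : i ≤ 2 * s + 1), hneg, ← mul_assoc,
    ← Finset.prod_mul_distrib]
  refine mul_nonneg (Finset.prod_nonneg fun j hj => ?_) (Finset.prod_nonneg fun j hj => ?_)
  · rw [Finset.mem_Ico] at hj
    have h1 := Y.y_le_y (show j ≤ i - 1 by omega) (by omega)
    have h2 := Y.y_le_y (show 0 ≤ j by omega) (by omega)
    have h3 := Y.y_le_y his le_rfl
    rw [neg_one_mul, ← sin_neg]
    exact sin_nonneg_of_nonneg_of_le_pi (by linarith [hx.2]) (by linarith [hx.1])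
  · rw [Finset.mem_Ico] at hj
    have h1 := Y.y_le_y hj.1 (by omega)
    have h2 := Y.y_le_y (show j ≤ 2 * s by omega) le_rfl
    have h3 := Y.y_le_y (Nat.zero_le (i - 1)) (by omega)
    exact sin_nonneg_of_nonneg_of_le_pi (by linarith [hx.1]) (by linarith [hx.2])

lemma PtsColl.signFun_apply_y {i : ℕ} (hi : 1 ≤ i) (his : i ≤ 2 * s) :
    Y.signFun (Y.y i) = 0 :=
  Finset.prod_eq_zero (Finset.mem_Icc.2 ⟨hi, his⟩) (by simp)

lemma PtsColl.deriv_signFun_pos (hs : 1 ≤ s) : 0 < deriv Y.signFun (Y.y 1) := by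
  set R : ℝ → ℝ := fun x => ∏ j ∈ Finset.Ico 2 (2 * s + 1), sin ((x - Y.y j) / 2)
  have hR : 0 < R (Y.y 1) := Finset.prod_pos fun j hj => by
    rw [Finset.mem_Ico] at hj
    have h1 := Y.y_lt_y (show 1 < j by omega) (by omega)
    have h2 := Y.y_le_y (show j ≤ 2 * s by omega) le_rfl
    have h3 := Y.y_lt_y (show 0 < 1 by omega) (by omega)
    have h4 := Y.per
    exact sin_pos_of_pos_of_lt_pi (by linarith) (by linarith)
  have hR' : DifferentiableAt ℝ R (Y.y 1) := by
    have : ContDiff ℝ ⊤ R := contDiff_prod fun j _ =>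
      contDiff_sin.comp ((contDiff_id.sub contDiff_const).div_const _)
    exact this.differentiable (by simp) _
  have hsplit : Y.signFun = fun x => sin ((x - Y.y 1) / 2) * R x := by
    funext x
    rw [PtsColl.signFun, ← Finset.Ico_add_one_right_eq_Icc,
      Finset.prod_eq_prod_Ico_succ_bot (by omega)]
  have hd : HasDerivAt (fun x => sin ((x - Y.y 1) / 2)) (cos ((Y.y 1 - Y.y 1) / 2) * (1 / 2))
      (Y.y 1) := (((hasDerivAt_id (Y.y 1)).sub_const (Y.y 1)).div_const 2).sin
  rw [hsplit, HasDerivAt.deriv (hd.fun_mul hR'.hasDerivAt)]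
  simpa using hR

end SignFunction

section Comonotonicity

lemma QMonotoneOn.iteratedDeriv_nonneg {q : ℕ} (hq : 2 ≤ q) {f : ℝ → ℝ} (hf : ContDiff ℝ ⊤ f)
    {a b : ℝ} (h : QMonotoneOn q f a b) {x : ℝ} (hx : x ∈ Ioo a b) : 0 ≤ iteratedDeriv q f x := by
  obtain ⟨m, rfl⟩ : ∃ m, q = m + 2 := ⟨q - 2, by omega⟩
  have hconv : ConvexOn ℝ (Ioo a b) (iteratedDeriv m f) :=
    h.2.2.congr (iteratedDerivWithin_of_isOpen isOpen_Ioo)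
  have hmono := hconv.monotoneOn_deriv
    fun y _ => (hasDerivAt_iteratedDeriv hf m y).differentiableAt
  rw [← iteratedDeriv_succ] at hmono
  have := hmono.derivWithin_nonneg (x := x)
  rwa [derivWithin_of_isOpen isOpen_Ioo hx, ← iteratedDeriv_succ] at this

lemma integral_iteratedDeriv_mul_signFun_nonneg {q s : ℕ} (hq : 2 ≤ q) (Y : PtsColl s)
    {T : ℝ → ℝ} (hT : ContDiff ℝ ⊤ T) (h : DeltaQ q s Y T) (a : ℝ) :
    0 ≤ ∫ x in a..a + 2 * π, iteratedDeriv q T x * Y.signFun x := by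
  have hp : Function.Periodic (fun x => iteratedDeriv q T x * Y.signFun x) (2 * π) :=
    (periodic_iteratedDeriv h.2.1 q).mul Y.signFun_periodic
  rw [hp.intervalIntegral_add_eq a (Y.y (2 * s)), ← Y.per]
  have hle : Y.y (2 * s) ≤ Y.y 0 := Y.y_le_y (Nat.zero_le _) le_rfl
  rw [intervalIntegral.integral_congr_Ioo_of_le hle
    (g := fun x => |iteratedDeriv q T x * Y.signFun x|)]
  · exact intervalIntegral.integral_nonneg hle fun _ _ => abs_nonneg _
  intro x ⟨hx1, hx2⟩
  have hex : ∃ i, Y.y i ≤ x := ⟨_, hx1.le⟩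
  classical
  set i := Nat.find hex
  have hi : Y.y i ≤ x := Nat.find_spec hex
  have his : i ≤ 2 * s := Nat.find_le hx1.le
  have hi1 : 1 ≤ i := by
    rcases Nat.eq_zero_or_pos i with h0 | h0
    · rw [h0] at hi; linarith
    · exact h0
  have hi2 : x < Y.y (i - 1) := not_le.1 (Nat.find_min hex (show i - 1 < i by omega))
  refine (abs_of_nonneg ?_).symm
  rcases hi.eq_or_lt with h0 | h0
  · simp only [← h0, Y.signFun_apply_y hi1 his, mul_zero, le_refl]
  have h1 := (h.2.2 i hi1 his).iteratedDeriv_nonneg hq (contDiff_const.mul hT) ⟨h0, hi2⟩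
  rw [iteratedDeriv_const_mul_field] at h1
  have h2 := Y.signFun_nonneg hi1 his ⟨hi, hi2.le⟩
  have h3 : ((-1 : ℝ) ^ (i - 1)) * (-1) ^ (i - 1) = 1 := by
    rw [← mul_pow]; simp
  calc (0 : ℝ) ≤ ((-1) ^ (i - 1) * iteratedDeriv q T x) * ((-1) ^ (i - 1) * Y.signFun x) :=
        mul_nonneg h1 h2
    _ = (((-1 : ℝ) ^ (i - 1)) * (-1) ^ (i - 1)) * (iteratedDeriv q T x * Y.signFun x) := by ring
    _ = _ := by rw [h3, one_mul]

lemma IsTrigPoly.contDiff {n : ℕ} {T : ℝ → ℝ} (h : IsTrigPoly n T) : ContDiff ℝ ⊤ T := by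
  obtain ⟨a, b, hT⟩ := h
  rw [funext hT]
  refine contDiff_const.add (ContDiff.sum fun k _ => ?_)
  exact (contDiff_const.mul (contDiff_cos.comp (contDiff_const.mul contDiff_id))).add
    (contDiff_const.mul (contDiff_sin.comp (contDiff_const.mul contDiff_id)))

lemma isTrigPoly_zero (n : ℕ) : IsTrigPoly n fun _ => 0 := ⟨0, 0, by simp⟩

lemma deltaQ_zero (q s : ℕ) (Y : PtsColl s) : DeltaQ q s Y fun _ => 0 := by
  refine ⟨continuous_const, fun _ => rfl, fun i _ _ => ?_⟩
  simp only [mul_zero]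
  refine ⟨continuousOn_const, contDiffOn_const, ?_⟩
  refine (convexOn_const (0 : ℝ) (convex_Ioo _ _)).congr fun x hx => ?_
  rw [iteratedDerivWithin_of_isOpen isOpen_Ioo hx]
  simp

lemma bddAbove_range_abs_of_periodic {h : ℝ → ℝ} (hc : Continuous h) {c : ℝ} (hc0 : c ≠ 0)
    (hp : Function.Periodic h c) : BddAbove (range fun x => |h x|) := by
  obtain ⟨B, hB⟩ := hp.compact_of_continuous hc0 hc |>.isBounded.exists_norm_le
  exact ⟨B, by rintro _ ⟨x, rfl⟩; exact hB _ ⟨x, rfl⟩⟩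

lemma abs_integral_mul_le_iSup {h g : ℝ → ℝ} (hc : Continuous h) (hg : Continuous g)
    (hb : BddAbove (range fun x => |h x|)) {a b : ℝ} (hab : a ≤ b) :
    |∫ x in a..b, h x * g x| ≤ (⨆ x, |h x|) * ∫ x in a..b, |g x| := by
  rw [← intervalIntegral.integral_const_mul]
  refine (intervalIntegral.abs_integral_le_integral_abs hab).trans ?_
  refine intervalIntegral.integral_mono_on hab
    ((hc.mul hg).abs.intervalIntegrable _ _) ((hg.abs.const_mul _).intervalIntegrable _ _) ?_
  intro x _
  rw [abs_mul]
  exact mul_le_mul_of_nonneg_right (le_ciSup hb x) (abs_nonneg _)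

end Comonotonicity

section ExtremalFunction

lemma qMonotoneOn_of_eqOn_scaledBernoulli {q : ℕ} (hq : 3 ≤ q) {f : ℝ → ℝ} (hf : Continuous f)
    {a b c d : ℝ}
    (h : EqOn f (fun x => c * scaledBernoulli (q - 1) (x - d)) (Ioo a b)) :
    QMonotoneOn q f a b := by
  set H : ℕ → ℝ → ℝ := fun j x => c * scaledBernoulli (j + 1) (x - d)
  have hH : ∀ i x, HasDerivAt (H (i + 1)) (H i x) x := fun i x =>
    ((hasDerivAt_scaledBernoulli (i + 1) (x - d)).comp_sub_const x d).const_mul c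
  have h0 : ∀ x, H 0 x = c * (x - d - π) := fun x => by simp [H, scaledBernoulli_one]
  have hc0 : Continuous (H 0) := by rw [funext h0]; fun_prop
  have h' : EqOn f (H (q - 2)) (Ioo a b) := by
    simpa only [H, show q - 2 + 1 = q - 1 by omega] using h
  refine ⟨hf.continuousOn, (contDiff_tower hH hc0 _).contDiffOn.congr h', ?_⟩
  have hconv : ConvexOn ℝ (Ioo a b) (H 0) := by
    refine ⟨convex_Ioo a b, fun x _ y _ u v _ _ huv => le_of_eq ?_⟩
    obtain rfl : v = 1 - u := by linarith
    simp only [h0, smul_eq_mul]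
    ring
  refine hconv.congr fun x hx => ?_
  rw [iteratedDerivWithin_congr h' hx, iteratedDerivWithin_of_isOpen isOpen_Ioo hx,
    iteratedDeriv_tower hH]

lemma deltaQ_const_mul_periodicBernoulli {q s : ℕ} (hq : 3 ≤ q) (hs : 1 ≤ s) (Y : PtsColl s)
    (c : ℝ) : DeltaQ q s Y fun x => c * periodicBernoulli (Y.y 1) (q - 1) x := by
  have hcont := (continuous_periodicBernoulli (Y.y 1) (k := q - 1) (by omega)).const_mul c
  refine ⟨hcont, fun x => congrArg _ (periodicBernoulli_periodic _ _ x), fun i hi his => ?_⟩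
  obtain ⟨n, hn⟩ : ∃ n : ℤ, Ioo (Y.y i) (Y.y (i - 1)) ⊆
      Ioo (Y.y 1 + 2 * π * n) (Y.y 1 + 2 * π * n + 2 * π) := by
    have hper := Y.per
    have h0 := Y.y_le_y (show 1 ≤ 2 * s by omega) le_rfl
    rcases hi.eq_or_lt with rfl | hi1
    · exact ⟨0, Ioo_subset_Ioo (by simp) (by simp; linarith)⟩
    · have h1 := Y.y_le_y his le_rfl
      have h2 := Y.y_lt_y (show 0 < 1 by omega) (by omega)
      have h3 := Y.y_le_y (show 1 ≤ i - 1 by omega) (by omega)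
      refine ⟨-1, Ioo_subset_Ioo ?_ ?_⟩ <;> push_cast <;> linarith
  refine qMonotoneOn_of_eqOn_scaledBernoulli hq (hcont.const_mul _)
    (c := (-1) ^ (i - 1) * c) (d := Y.y 1 + 2 * π * n) fun x hx => ?_
  simp only [periodicBernoulli_eqOn (Y.y 1) (q - 1) n (hn hx), mul_assoc]

lemma sobolevW_const_mul_periodicBernoulli {q r : ℕ} (hr : 1 ≤ r) (hrq : r + 2 ≤ q)
    (a c : ℝ) (hc : ∀ x, |c * periodicBernoulli a (q - r - 1) x| ≤ 2) :
    SobolevW r fun x => c * periodicBernoulli a (q - 1) x := by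
  set H : ℕ → ℝ → ℝ := fun j x => c * periodicBernoulli a (q - r + j) x
  have hH : ∀ i x, HasDerivAt (H (i + 1)) (H i x) x := fun i x =>
    (hasDerivAt_periodicBernoulli a (k := q - r + i) (by omega) x).const_mul c
  have h0 : Continuous (H 0) :=
    (continuous_periodicBernoulli a (k := q - r + 0) (by omega)).const_mul c
  have hf : (fun x => c * periodicBernoulli a (q - 1) x) = H (r - 1) := by
    simp only [H, show q - r + (r - 1) = q - 1 by omega]
  refine ⟨fun x => congrArg _ (periodicBernoulli_periodic _ _ x), ?_, _, fun b d => ?_,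
    Filter.Eventually.of_forall hc, fun x => ?_⟩
  · rw [hf]
    exact contDiff_tower hH h0 _
  · exact (intervalIntegrable_periodicBernoulli a _ b d).const_mul c
  · rw [hf, iteratedDeriv_tower hH, intervalIntegral.integral_const_mul,
      integral_periodicBernoulli a (by omega)]
    simp only [H, add_zero, show q - r - 1 + 1 = q - r by omega]
    ring

/-- The best approximation error of a function is bounded below by pairing it with the `q`-th
derivative of `Y.signFun`. -/
lemma le_errCoQ_of_integral_signFun {q s : ℕ} (hq : 2 ≤ q) (Y : PtsColl s) {f : ℝ → ℝ}
    (hf : Continuous f) (pf : Function.Periodic f (2 * π)) (a : ℝ) (n : ℕ) :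
    -((-1) ^ q * ∫ x in a..a + 2 * π, f x * iteratedDeriv q Y.signFun x) /
        ((∫ x in a..a + 2 * π, |iteratedDeriv q Y.signFun x|) + 1) ≤ ErrCoQ q n s Y f := by
  refine le_csInf ⟨_, _, ⟨isTrigPoly_zero n, deltaQ_zero q s Y⟩, rfl⟩ ?_
  rintro _ ⟨T, ⟨hT, hΔ⟩, rfl⟩
  have hab : a ≤ a + 2 * π := by linarith [pi_pos]
  have hψ := continuous_iteratedDeriv_top Y.contDiff_signFun q
  have hTs := hT.contDiff
  have hTc := hTs.continuous
  have hb := bddAbove_range_abs_of_periodic (hf.sub hTc) (c := 2 * π) (by positivity)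
    (pf.sub hΔ.2.1)
  have hle := abs_integral_mul_le_iSup (hf.sub hTc) hψ hb hab
  simp only [Pi.sub_apply] at hle
  have hM : 0 ≤ ⨆ x, |f x - T x| := Real.iSup_nonneg fun _ => abs_nonneg _
  have hK : 0 ≤ ∫ x in a..a + 2 * π, |iteratedDeriv q Y.signFun x| :=
    intervalIntegral.integral_nonneg hab fun _ _ => abs_nonneg _
  have hTpos : 0 ≤ (-1) ^ q * ∫ x in a..a + 2 * π, T x * iteratedDeriv q Y.signFun x := by
    have h := integral_mul_iteratedDeriv_of_periodic (a := a) hTs Y.contDiff_signFun hΔ.2.1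
      Y.signFun_periodic q 0
    simp only [iteratedDeriv_zero, zero_add] at h
    rw [h, ← mul_assoc, ← mul_pow]
    simpa using integral_iteratedDeriv_mul_signFun_nonneg hq Y hTs hΔ a
  have hsub : ∫ x in a..a + 2 * π, (f x - T x) * iteratedDeriv q Y.signFun x =
      (∫ x in a..a + 2 * π, f x * iteratedDeriv q Y.signFun x) -
        ∫ x in a..a + 2 * π, T x * iteratedDeriv q Y.signFun x := by
    simp only [sub_mul]
    exact intervalIntegral.integral_sub ((hf.mul hψ).intervalIntegrable _ _)
      ((hTc.mul hψ).intervalIntegrable _ _)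
  have habs : -((-1) ^ q * ∫ x in a..a + 2 * π, (f x - T x) * iteratedDeriv q Y.signFun x) ≤
      |∫ x in a..a + 2 * π, (f x - T x) * iteratedDeriv q Y.signFun x| := by
    refine (neg_le_abs _).trans_eq ?_
    simp [abs_mul]
  rw [hsub] at habs hle
  rw [div_le_iff₀ (by linarith)]
  nlinarith

end ExtremalFunction

/-- **Corollary 1.3.** For each `q ≥ 3`, `r ≤ q - 2`, `s ∈ ℕ` and any `Y_s ∈ 𝕐_s`, there exists
a function `f ∈ Δ^(q)(Y_s) ∩ W^r` and a constant `C = C(q, Y_s) > 0` such that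
`E_n^(q)(f, Y_s) ≥ C` for all `n ∈ ℕ`. -/
theorem lower_bound_W_r_le_q_sub_two (q r s : ℕ) (hq : 3 ≤ q) (hr : 1 ≤ r) (hrq : r ≤ q - 2)
    (hs : 1 ≤ s) (Y : PtsColl s) :
    ∃ f : ℝ → ℝ, ∃ C : ℝ, 0 < C ∧ DeltaQ q s Y f ∧ SobolevW r f ∧
      ∀ n : ℕ, 1 ≤ n → C ≤ ErrCoQ q n s Y f := by
  obtain ⟨B, hB⟩ := exists_bound_periodicBernoulli (Y.y 1) (q - r - 1)
  have hB0 : 0 ≤ B := (abs_nonneg _).trans (hB 0)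
  set ε : ℝ := 2 / (B + 1) with hε
  have hε0 : 0 < ε := by positivity
  have hder := Y.deriv_signFun_pos hs
  have hΔ := deltaQ_const_mul_periodicBernoulli hq hs Y (-ε)
  have hint : -((-1) ^ q * ∫ x in Y.y 1..Y.y 1 + 2 * π,
      (-ε * periodicBernoulli (Y.y 1) (q - 1) x) * iteratedDeriv q Y.signFun x) =
      ε * (2 * π * deriv Y.signFun (Y.y 1)) := by
    obtain ⟨k, rfl⟩ : ∃ k, q = k + 2 := ⟨q - 2, by omega⟩
    simp only [mul_assoc (-ε), intervalIntegral.integral_const_mul]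
    rw [show k + 2 - 1 = k + 1 by omega, integral_periodicBernoulli_mul_iteratedDeriv
      Y.contDiff_signFun Y.signFun_periodic]
    have hsq : ((-1 : ℝ) ^ k) * (-1) ^ k = 1 := by rw [← mul_pow]; simp
    linear_combination ε * (2 * π * deriv Y.signFun (Y.y 1)) * hsq
  refine ⟨_, ε * (2 * π * deriv Y.signFun (Y.y 1)) /
    ((∫ x in Y.y 1..Y.y 1 + 2 * π, |iteratedDeriv q Y.signFun x|) + 1), ?_, hΔ,
    sobolevW_const_mul_periodicBernoulli hr (by omega) _ _ fun x => ?_, fun n _ => ?_⟩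
  · have hK : 0 ≤ ∫ x in Y.y 1..Y.y 1 + 2 * π, |iteratedDeriv q Y.signFun x| :=
      intervalIntegral.integral_nonneg (by linarith [pi_pos]) fun _ _ => abs_nonneg _
    positivity
  · rw [abs_mul, abs_neg, abs_of_pos hε0, hε, div_mul_eq_mul_div, div_le_iff₀ (by positivity)]
    linarith [hB x]
  · rw [← hint]
    exact le_errCoQ_of_integral_signFun (by omega) Y hΔ.1 hΔ.2.1 (Y.y 1) n
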